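/- Failure of H² regularity for the degenerate model problem: with c = (√5 - 1)/2 and u(x) = x^c / c - x, for every x ∈ (0,1) the second derivative satisfies deriv (deriv u) x = (c - 1)·x^(c-2), and the function x ↦ (deriv (deriv u) x)² is NOT integrable on the interval (0,1) with respect to Lebesgue measure, i.e. u'' is not square integrable. -/

import Mathlib

open MeasureTheory

theorem hasDerivAt_rpow_div_sub_id {c x : ℝ} (hc : c ≠ 0) (hx : 0 < x) :
    HasDerivAt (fun y : ℝ => y ^ c / c - y) (x ^ (c - 1) - 1) x := by
  refine (((Real.hasDerivAt_rpow_const (p := c) (Or.inl hx.ne')).div_const c).sub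
    (hasDerivAt_id x)).congr_deriv ?_
  rw [mul_div_cancel_left₀ _ hc]

theorem deriv_deriv_rpow_div_sub_id {c x : ℝ} (hc : c ≠ 0) (hx : 0 < x) :
    deriv (deriv fun y : ℝ => y ^ c / c - y) x = (c - 1) * x ^ (c - 2) := by
  have h : deriv (fun y : ℝ => y ^ c / c - y) =ᶠ[nhds x] fun y => y ^ (c - 1) - 1 := by
    filter_upwards [Ioi_mem_nhds hx] with y hy
    exact (hasDerivAt_rpow_div_sub_id hc hy).deriv
  rw [h.deriv_eq,
    ((Real.hasDerivAt_rpow_const (p := c - 1) (Or.inl hx.ne')).sub_const 1).deriv]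
  ring_nf

theorem not_integrableOn_sq_const_mul_rpow {a p : ℝ} (ha : a ≠ 0) (hp : p ≤ -(1 / 2)) :
    ¬ IntegrableOn (fun x : ℝ => (a * x ^ p) ^ 2) (Set.Ioo 0 1) volume := by
  intro h
  have h' : IntegrableOn (fun x : ℝ => x ^ (p * 2)) (Set.Ioo 0 1) volume := by
    refine IntegrableOn.congr_fun (h.const_mul (a ^ 2)⁻¹) (fun x hx => ?_) measurableSet_Ioo
    have hpow : x ^ (p * 2) = (x ^ p) ^ 2 := by
      rw [Real.rpow_mul hx.1.le, Real.rpow_two]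
    simp only [hpow]
    field_simp
  rw [intervalIntegral.integrableOn_Ioo_rpow_iff one_pos] at h'
  linarith

theorem degenerate_model_H2_failure
    (c : ℝ) (hc : c = (Real.sqrt 5 - 1) / 2)
    (u : ℝ → ℝ) (hu : ∀ x : ℝ, u x = x ^ c / c - x) :
    (∀ x ∈ Set.Ioo (0 : ℝ) 1,
      deriv (deriv u) x = (c - 1) * x ^ (c - 2)) ∧
    ¬ IntegrableOn (fun x : ℝ => (deriv (deriv u) x) ^ 2) (Set.Ioo 0 1) volume := by
  obtain rfl : u = fun x => x ^ c / c - x := funext hu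
  have h5 : Real.sqrt 5 < 3 := (Real.sqrt_lt' (by norm_num)).2 (by norm_num)
  have h5' : 1 < Real.sqrt 5 := Real.lt_sqrt_of_sq_lt (by norm_num)
  have hc0 : c ≠ 0 := ne_of_gt (by linarith)
  have hc1 : c - 1 ≠ 0 := ne_of_lt (by linarith)
  have hderiv : ∀ x ∈ Set.Ioo (0 : ℝ) 1,
      deriv (deriv fun y : ℝ => y ^ c / c - y) x = (c - 1) * x ^ (c - 2) :=
    fun x hx => deriv_deriv_rpow_div_sub_id hc0 hx.1
  refine ⟨hderiv, fun h => not_integrableOn_sq_const_mul_rpow hc1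
    (by linarith : c - 2 ≤ -(1 / 2)) (h.congr_fun (fun x hx => ?_) measurableSet_Ioo)⟩
  simp only [hderiv x hx]
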